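/- Joint Hölder continuity of the flow: Let W : ℝ × ℝ^d → ℝ^d satisfy condition (W) with τ, λ ∈ (0,1], τ(1+λ) > 1 and β + λ ≤ 1, be differentiable in x, and suppose that for every T > 0 and compact K ⊂ ℝ^d the quantity sup_{s<t ∈ [−T,T], x ∈ K} |∇W(t,x) − ∇W(s,x)|/|t−s|^τ + sup_{s<t ∈ [−T,T], x≠y ∈ K} |∇W(t,x) − ∇W(s,x) − ∇W(t,y) + ∇W(s,y)|/(|t−s|^τ |x−y|^λ) is finite. For each x ∈ ℝ^d let φ(·, x) denote the unique solution of φ(t, x) = x + ∫_0^t W(ds, φ(s, x)). Then φ is jointly Hölder continuous of order (τ, 1): for every T > 0 and every compact set K ⊂ ℝ^d there is a constant C such that |φ(s,x) − φ(s,y) − φ(t,x) + φ(t,y)| ≤ C |t−s|^τ |x−y| for all s, t ∈ [−T, T] and x, y ∈ K. -/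

import Mathlib

open scoped BigOperators

noncomputable section

/-- `t : Fin (m+1) → ℝ` is a partition `a = t₀ < t₁ < ⋯ < t_m = b` of `[a,b]`. -/
def IsPartition (a b : ℝ) (m : ℕ) (t : Fin (m + 1) → ℝ) : Prop :=
  StrictMono t ∧ t 0 = a ∧ t (Fin.last m) = b

/-- The mesh `|π| = max_i (t_{i+1} - t_i)` of a partition. -/
def partMesh (m : ℕ) (t : Fin (m + 1) → ℝ) : ℝ :=
  ⨆ i : Fin m, (t i.succ - t i.castSucc)

/-- The Riemann sums `Σ_{i=0}^{m-1} μ(t_i, t_{i+1})` over partitions of `[a,b]`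
converge to `I` as the mesh tends to `0`. -/
def RiemannLimit {B : Type*} [NormedAddCommGroup B] (a b : ℝ) (μ : ℝ → ℝ → B) (I : B) : Prop :=
  ∀ ε : ℝ, 0 < ε → ∃ δ : ℝ, 0 < δ ∧ ∀ (m : ℕ) (t : Fin (m + 1) → ℝ),
    IsPartition a b m t → partMesh m t < δ →
    ‖(∑ i : Fin m, μ (t i.castSucc) (t i.succ)) - I‖ < ε

/-- The germ of the nonlinear Young integral `∫ W(ds, φ_s)`:
`(s,t) ↦ W(t, φ_s) − W(s, φ_s)`. -/
def youngGerm {d : ℕ} (W : ℝ → EuclideanSpace ℝ (Fin d) → EuclideanSpace ℝ (Fin d))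
    (φ : ℝ → EuclideanSpace ℝ (Fin d)) : ℝ → ℝ → EuclideanSpace ℝ (Fin d) :=
  fun s t => W t (φ s) - W s (φ s)

/-- `I` is the value of the nonlinear Young integral `∫_a^b W(ds, φ_s)`, i.e. the limit of
the Riemann sums `Σ_i (W(t_{i+1}, φ_{t_i}) − W(t_i, φ_{t_i}))` as the mesh tends to `0`. -/
def HasYoungIntegral {d : ℕ} (W : ℝ → EuclideanSpace ℝ (Fin d) → EuclideanSpace ℝ (Fin d))
    (φ : ℝ → EuclideanSpace ℝ (Fin d)) (a b : ℝ) (I : EuclideanSpace ℝ (Fin d)) : Prop :=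
  RiemannLimit a b (youngGerm W φ) I

/-- The set of quotients entering the Hölder seminorm `‖φ‖_{γ;a,b}`. -/
def holderSet {F : Type*} [NormedAddCommGroup F] (φ : ℝ → F) (γ a b : ℝ) : Set ℝ :=
  {r | ∃ s t : ℝ, a ≤ s ∧ s < t ∧ t ≤ b ∧ r = ‖φ t - φ s‖ / (t - s) ^ γ}

/-- The Hölder seminorm `‖φ‖_{γ;a,b} = sup_{a ≤ s < t ≤ b} ‖φ_t − φ_s‖/(t−s)^γ`. -/
def holderSemi {F : Type*} [NormedAddCommGroup F] (φ : ℝ → F) (γ a b : ℝ) : ℝ :=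
  sSup (holderSet φ γ a b)

/-- `φ` is `γ`-Hölder continuous on `[a,b]`. -/
def HolderOn {F : Type*} [NormedAddCommGroup F] (φ : ℝ → F) (γ a b : ℝ) : Prop :=
  BddAbove (holderSet φ γ a b)

/-- The sup norm `‖φ‖_{∞;a,b} = sup_{a ≤ t ≤ b} ‖φ_t‖`. -/
def supNorm {F : Type*} [NormedAddCommGroup F] (φ : ℝ → F) (a b : ℝ) : ℝ :=
  sSup ((fun u => ‖φ u‖) '' Set.Icc a b)

/-- Quotients of the first term of the seminorm `‖W‖_{β,τ,λ;a,b}` ( = `[W]_{β,τ,λ;a,b}`). -/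
def wSet1 {d : ℕ} (W : ℝ → EuclideanSpace ℝ (Fin d) → EuclideanSpace ℝ (Fin d))
    (β τ lam a b : ℝ) : Set ℝ :=
  {r | ∃ (s t : ℝ) (x y : EuclideanSpace ℝ (Fin d)), a ≤ s ∧ s < t ∧ t ≤ b ∧ x ≠ y ∧
    r = ‖W s x - W t x - W s y + W t y‖ /
      ((1 + ‖x‖ + ‖y‖) ^ β * (t - s) ^ τ * ‖x - y‖ ^ lam)}

/-- Quotients of the second term of the seminorm `‖W‖_{β,τ,λ;a,b}`. -/
def wSet2 {d : ℕ} (W : ℝ → EuclideanSpace ℝ (Fin d) → EuclideanSpace ℝ (Fin d))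
    (β τ lam a b : ℝ) : Set ℝ :=
  {r | ∃ (s t : ℝ) (x : EuclideanSpace ℝ (Fin d)), a ≤ s ∧ s < t ∧ t ≤ b ∧
    r = ‖W s x - W t x‖ / ((1 + ‖x‖) ^ (β + lam) * (t - s) ^ τ)}

/-- Quotients of the third term of the seminorm `‖W‖_{β,τ,λ;a,b}`. -/
def wSet3 {d : ℕ} (W : ℝ → EuclideanSpace ℝ (Fin d) → EuclideanSpace ℝ (Fin d))
    (β τ lam a b : ℝ) : Set ℝ :=
  {r | ∃ (t : ℝ) (x y : EuclideanSpace ℝ (Fin d)), a ≤ t ∧ t ≤ b ∧ x ≠ y ∧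
    r = ‖W t x - W t y‖ / ((1 + ‖x‖ + ‖y‖) ^ β * ‖x - y‖ ^ lam)}

/-- Condition (W) on `[a,b]`: the seminorm `‖W‖_{β,τ,λ;a,b}` is finite. -/
def ConditionW {d : ℕ} (W : ℝ → EuclideanSpace ℝ (Fin d) → EuclideanSpace ℝ (Fin d))
    (β τ lam a b : ℝ) : Prop :=
  BddAbove (wSet1 W β τ lam a b) ∧ BddAbove (wSet2 W β τ lam a b) ∧
    BddAbove (wSet3 W β τ lam a b)

/-- The seminorm `‖W‖_{β,τ,λ;a,b}` (sum of the three suprema). -/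
def wNorm {d : ℕ} (W : ℝ → EuclideanSpace ℝ (Fin d) → EuclideanSpace ℝ (Fin d))
    (β τ lam a b : ℝ) : ℝ :=
  sSup (wSet1 W β τ lam a b) + sSup (wSet2 W β τ lam a b) + sSup (wSet3 W β τ lam a b)

/-- The first supremum `[W]_{β,τ,λ;a,b}` alone. -/
def wBracket {d : ℕ} (W : ℝ → EuclideanSpace ℝ (Fin d) → EuclideanSpace ℝ (Fin d))
    (β τ lam a b : ℝ) : ℝ :=
  sSup (wSet1 W β τ lam a b)


/-- Signed nonlinear Young integral `∫_s^t W(dr, φ_r)` (with the convention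
`∫_s^t = −∫_t^s` when `t < s`). -/
def HasSignedYoungIntegral {d : ℕ}
    (W : ℝ → EuclideanSpace ℝ (Fin d) → EuclideanSpace ℝ (Fin d))
    (φ : ℝ → EuclideanSpace ℝ (Fin d)) (s t : ℝ) (I : EuclideanSpace ℝ (Fin d)) : Prop :=
  (s ≤ t ∧ HasYoungIntegral W φ s t I) ∨ (t < s ∧ HasYoungIntegral W φ t s (-I))

/-- The spatial gradient `∇W(t,x)` (as a continuous linear map). -/
def gradW {d : ℕ} (W : ℝ → EuclideanSpace ℝ (Fin d) → EuclideanSpace ℝ (Fin d))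
    (t : ℝ) (x : EuclideanSpace ℝ (Fin d)) :
    EuclideanSpace ℝ (Fin d) →L[ℝ] EuclideanSpace ℝ (Fin d) :=
  fderiv ℝ (W t) x

/-- Quotients of the first term of `‖∇W‖_{τ,λ;[a,b]×K}`. -/
def gradWSet1 {d : ℕ} (W : ℝ → EuclideanSpace ℝ (Fin d) → EuclideanSpace ℝ (Fin d))
    (τ a b : ℝ) (K : Set (EuclideanSpace ℝ (Fin d))) : Set ℝ :=
  {r | ∃ (s t : ℝ) (x : EuclideanSpace ℝ (Fin d)), a ≤ s ∧ s < t ∧ t ≤ b ∧ x ∈ K ∧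
    r = ‖gradW W t x - gradW W s x‖ / (t - s) ^ τ}

/-- Quotients of the second term of `‖∇W‖_{τ,λ;[a,b]×K}`. -/
def gradWSet2 {d : ℕ} (W : ℝ → EuclideanSpace ℝ (Fin d) → EuclideanSpace ℝ (Fin d))
    (τ lam a b : ℝ) (K : Set (EuclideanSpace ℝ (Fin d))) : Set ℝ :=
  {r | ∃ (s t : ℝ) (x y : EuclideanSpace ℝ (Fin d)),
    a ≤ s ∧ s < t ∧ t ≤ b ∧ x ∈ K ∧ y ∈ K ∧ x ≠ y ∧
    r = ‖gradW W t x - gradW W s x - gradW W t y + gradW W s y‖ /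
      ((t - s) ^ τ * ‖x - y‖ ^ lam)}

open Filter Topology

/-- Riemann sum over the uniform partition of `[a,b]` in `N` pieces. -/
def unifSum {B : Type*} [NormedAddCommGroup B] (μ : ℝ → ℝ → B) (a b : ℝ) (N : ℕ) : B :=
  ∑ i ∈ Finset.range N, μ (a + (b - a) * ((i : ℝ) / N)) (a + (b - a) * (((i + 1 : ℕ) : ℝ) / N))

lemma riemann_seq {B : Type*} [NormedAddCommGroup B] {a b : ℝ} {μ : ℝ → ℝ → B} {I : B}
    (h : RiemannLimit a b μ I) {ε : ℝ} (hε : 0 < ε) :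
    ∃ δ : ℝ, 0 < δ ∧ ∀ (m : ℕ) (g : ℕ → ℝ), g 0 = a → g m = b →
      (∀ i, i < m → g i < g (i + 1)) → (∀ i, i < m → g (i + 1) - g i < δ) →
      ‖(∑ i ∈ Finset.range m, μ (g i) (g (i + 1))) - I‖ < ε := by
  obtain ⟨δ, hδ, H⟩ := h ε hε
  refine ⟨δ / 2, by positivity, fun m g h0 hm hmono hst => ?_⟩
  have := H m (fun i => g i) ⟨?_, by simpa using h0, by simpa using hm⟩ ?_
  · rw [Finset.sum_range]
    simpa using this
  · rw [Fin.strictMono_iff_lt_succ]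
    intro i
    simpa using hmono i i.2
  · refine lt_of_le_of_lt (Real.iSup_le (a := δ / 2) (fun i => ?_) (by positivity)) (by linarith)
    simpa using (hst i i.2).le

lemma unif_step_lt {a b : ℝ} (hab : a < b) {N : ℕ} (hN : 0 < N) (i : ℕ) :
    a + (b - a) * ((i : ℝ) / N) < a + (b - a) * (((i + 1 : ℕ) : ℝ) / N) := by
  have hN' : (0 : ℝ) < N := by exact_mod_cast hN
  have : (i : ℝ) / N < ((i + 1 : ℕ) : ℝ) / N := by
    gcongr; linarith
  have := mul_lt_mul_of_pos_left this (sub_pos.2 hab)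
  linarith

lemma unif_step_eq {a b : ℝ} (N : ℕ) (i : ℕ) :
    a + (b - a) * (((i + 1 : ℕ) : ℝ) / N) - (a + (b - a) * ((i : ℝ) / N)) = (b - a) / N := by
  push_cast; ring

lemma tendsto_unifSum {B : Type*} [NormedAddCommGroup B] {a b : ℝ} (hab : a < b)
    {μ : ℝ → ℝ → B} {I : B}
    (h : RiemannLimit a b μ I) : Tendsto (unifSum μ a b) atTop (𝓝 I) := by
  rw [Metric.tendsto_nhds]
  intro ε hε
  obtain ⟨δ, hδ, H⟩ := riemann_seq h hε
  have h1 := (tendsto_const_div_atTop_nhds_zero_nat (b - a)).eventually (gt_mem_nhds hδ)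
  filter_upwards [h1, eventually_gt_atTop 0] with N hN hN0
  rw [dist_eq_norm]
  have hN' : (N : ℝ) ≠ 0 := by exact_mod_cast hN0.ne'
  refine H N (fun i => a + (b - a) * ((i : ℝ) / N)) (by simp) (by field_simp; ring)
    (fun i _ => unif_step_lt hab hN0 i) (fun i _ => ?_)
  simpa only [unif_step_eq] using hN

lemma tendsto_unifSum_add {B : Type*} [NormedAddCommGroup B] {a b c : ℝ} (hab : a < b)
    (hbc : b < c) {μ : ℝ → ℝ → B} {I : B}
    (h : RiemannLimit a c μ I) :
    Tendsto (fun N => unifSum μ a b N + unifSum μ b c N) atTop (𝓝 I) := by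
  rw [Metric.tendsto_nhds]
  intro ε hε
  obtain ⟨δ, hδ, H⟩ := riemann_seq h hε
  have h1 := (tendsto_const_div_atTop_nhds_zero_nat (b - a)).eventually (gt_mem_nhds hδ)
  have h2 := (tendsto_const_div_atTop_nhds_zero_nat (c - b)).eventually (gt_mem_nhds hδ)
  filter_upwards [h1, h2, eventually_gt_atTop 0] with N hN1 hN2 hN0
  rw [dist_eq_norm]
  have hN' : (N : ℝ) ≠ 0 := by exact_mod_cast hN0.ne'
  let g : ℕ → ℝ := fun i => if i ≤ N then a + (b - a) * ((i : ℝ) / N)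
    else b + (c - b) * (((i - N : ℕ) : ℝ) / N)
  have g1 : ∀ i, i ≤ N → g i = a + (b - a) * ((i : ℝ) / N) := fun i hi => if_pos hi
  have g2 : ∀ i, g (N + i) = b + (c - b) * ((i : ℝ) / N) := by
    intro i
    rcases Nat.eq_zero_or_pos i with rfl | hi
    · rw [add_zero, g1 N le_rfl]; field_simp; ring
    · have : ¬ (N + i ≤ N) := by omega
      simp only [g, if_neg this, Nat.add_sub_cancel_left]
  have hs : ∀ i, i < N + N → (g i < g (i + 1) ∧ g (i + 1) - g i < δ) := by
    intro i hi
    by_cases hiN : i < N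
    · rw [g1 i hiN.le, g1 (i + 1) hiN, unif_step_eq]
      exact ⟨unif_step_lt hab hN0 i, hN1⟩
    · obtain ⟨j, rfl⟩ := Nat.exists_eq_add_of_le (not_lt.1 hiN)
      rw [g2 j, add_assoc, g2 (j + 1), unif_step_eq]
      exact ⟨unif_step_lt hbc hN0 j, hN2⟩
  have := H (N + N) g (by rw [g1 0 (by omega)]; simp) (by rw [g2]; field_simp; ring)
    (fun i hi => (hs i hi).1) (fun i hi => (hs i hi).2)
  rw [Finset.sum_range_add] at this
  have e1 : unifSum μ a b N = ∑ x ∈ Finset.range N, μ (g x) (g (x + 1)) := by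
    refine Finset.sum_congr rfl fun i hi => ?_
    rw [Finset.mem_range] at hi
    rw [g1 i hi.le, g1 (i + 1) hi]
  have e2 : unifSum μ b c N = ∑ x ∈ Finset.range N, μ (g (N + x)) (g (N + x + 1)) := by
    refine Finset.sum_congr rfl fun i hi => ?_
    rw [g2 i, add_assoc, g2 (i + 1)]
  rw [e1, e2]
  exact this

lemma unifSum_double {B : Type*} [NormedAddCommGroup B] (μ : ℝ → ℝ → B) (a b : ℝ) {N : ℕ}
    (hN : 0 < N) :
    unifSum μ a b (N + N) = unifSum μ a ((a + b) / 2) N + unifSum μ ((a + b) / 2) b N := by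
  have hN' : (N : ℝ) ≠ 0 := by exact_mod_cast hN.ne'
  unfold unifSum
  rw [Finset.sum_range_add]
  congr 1 <;> refine Finset.sum_congr rfl fun i _ => ?_
  · congr 1 <;> (push_cast; field_simp; ring)
  · congr 1 <;> (push_cast; field_simp; ring)

/-- The sewing constant. -/
def sewC (θ : ℝ) : ℝ := 1 / (1 - 2 * (1 / 2 : ℝ) ^ θ)

lemma half_rpow_lt {θ : ℝ} (hθ : 1 < θ) : 2 * (1 / 2 : ℝ) ^ θ < 1 := by
  have := Real.rpow_lt_rpow_of_exponent_gt (x := (1 / 2 : ℝ)) (by norm_num) (by norm_num) hθ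
  rw [Real.rpow_one] at this
  linarith

lemma sewC_pos {θ : ℝ} (hθ : 1 < θ) : 0 < sewC θ := by
  have := half_rpow_lt hθ
  unfold sewC
  apply one_div_pos.2; linarith

lemma sewC_eq {θ : ℝ} (hθ : 1 < θ) : 2 * (sewC θ * (1 / 2 : ℝ) ^ θ) + 1 = sewC θ := by
  have := half_rpow_lt hθ
  have h : 1 - 2 * (1 / 2 : ℝ) ^ θ ≠ 0 := by linarith
  unfold sewC
  field_simp
  ring

lemma sewing_pow {B : Type*} [NormedAddCommGroup B] {μ : ℝ → ℝ → B} {θ K : ℝ} (hθ : 1 < θ)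
    (n : ℕ) : ∀ s t : ℝ, s < t →
    (∀ u v, s ≤ u → u < v → v ≤ t →
      ‖μ u v - μ u ((u + v) / 2) - μ ((u + v) / 2) v‖ ≤ K * (v - u) ^ θ) →
    ‖unifSum μ s t (2 ^ n) - μ s t‖ ≤ sewC θ * K * (t - s) ^ θ := by
  induction n with
  | zero =>
    intro s t hst hδ
    have hK : 0 ≤ K * (t - s) ^ θ := (norm_nonneg _).trans (hδ s t le_rfl hst le_rfl)
    have : unifSum μ s t (2 ^ 0) = μ s t := by simp [unifSum]
    rw [this, sub_self, norm_zero, mul_assoc]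
    exact mul_nonneg (sewC_pos hθ).le hK
  | succ n ih =>
    intro s t hst hδ
    set m := (s + t) / 2 with hm
    have e : (2 : ℕ) ^ (n + 1) = 2 ^ n + 2 ^ n := by ring
    rw [e, unifSum_double μ s t (by positivity)]
    have i1 := ih s m (by linarith) (fun u v h1 h2 h3 => hδ u v h1 h2 (by linarith))
    have i2 := ih m t (by linarith) (fun u v h1 h2 h3 => hδ u v (by linarith) h2 h3)
    have i3 := hδ s t le_rfl hst le_rfl
    have e1 : (m - s) ^ θ = (1 / 2 : ℝ) ^ θ * (t - s) ^ θ := by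
      rw [← Real.mul_rpow (by norm_num) (by linarith)]; congr 1; rw [hm]; ring
    have e2 : (t - m) ^ θ = (1 / 2 : ℝ) ^ θ * (t - s) ^ θ := by
      rw [← Real.mul_rpow (by norm_num) (by linarith)]; congr 1; rw [hm]; ring
    rw [e1] at i1
    rw [e2] at i2
    have : unifSum μ s m (2 ^ n) + unifSum μ m t (2 ^ n) - μ s t
        = (unifSum μ s m (2 ^ n) - μ s m) + (unifSum μ m t (2 ^ n) - μ m t)
          - (μ s t - μ s m - μ m t) := by abel
    rw [this]
    refine (norm_sub_le _ _).trans ((add_le_add ((norm_add_le _ _).trans (add_le_add i1 i2))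
      i3).trans (le_of_eq ?_))
    conv_rhs => rw [← sewC_eq hθ]
    ring

lemma sewing {B : Type*} [NormedAddCommGroup B] {μ : ℝ → ℝ → B} {θ K : ℝ} (hθ : 1 < θ)
    {s t : ℝ} (hst : s < t)
    (hδ : ∀ u v, s ≤ u → u < v → v ≤ t →
      ‖μ u v - μ u ((u + v) / 2) - μ ((u + v) / 2) v‖ ≤ K * (v - u) ^ θ) {I : B}
    (hI : Tendsto (unifSum μ s t) atTop (𝓝 I)) :
    ‖I - μ s t‖ ≤ sewC θ * K * (t - s) ^ θ := by
  have h1 : Tendsto (fun n : ℕ => 2 ^ n) atTop (atTop : Filter ℕ) :=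
    tendsto_pow_atTop_atTop_of_one_lt (by norm_num)
  have h2 := ((hI.comp h1).sub_const (μ s t)).norm
  exact le_of_tendsto h2 (Eventually.of_forall fun n => sewing_pow hθ n s t hst hδ)

/-- Abstract Gronwall-type lemma. -/
lemma gronwall_abs {B : Type*} [NormedAddCommGroup B] {T τ κ C : ℝ} (hT : 0 < T) (hτ : 0 < τ)
    (hκ : 0 < κ) (hC : 0 ≤ C) : ∃ D : ℝ, 0 ≤ D ∧ ∀ (f : ℝ → B) (e n0 : ℝ), 0 ≤ e →
      0 ≤ n0 → (∀ u v, -T ≤ u → u ≤ v → v ≤ T → ‖f v - f u‖ ≤ n0 * (v - u) ^ τ) →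
      (∀ a b N n : ℝ, -T ≤ a → b ≤ T → b - a ≤ 1 → 0 ≤ N → 0 ≤ n →
        (∀ u, a ≤ u → u ≤ b → ‖f u‖ ≤ N) →
        (∀ u v, a ≤ u → u ≤ v → v ≤ b → ‖f v - f u‖ ≤ n * (v - u) ^ τ) →
        ∀ s t, a ≤ s → s < t → t ≤ b → (0 ≤ s ∨ t ≤ 0) →
          ‖f t - f s‖ ≤ C * (e + N + n * (t - s) ^ κ) * (t - s) ^ τ) →
      (∀ t, -T ≤ t → t ≤ T → ‖f t‖ ≤ D * (e + ‖f 0‖)) ∧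
      (∀ s t, -T ≤ s → s ≤ t → t ≤ T → ‖f t - f s‖ ≤ D * (e + ‖f 0‖) * (t - s) ^ τ) := by
  -- choose the step
  obtain ⟨h, hh0, hh1, hh⟩ : ∃ h : ℝ, 0 < h ∧ h ≤ 1 ∧ 2 * C * (h ^ τ + h ^ κ) ≤ 1 / 2 := by
    have c1 : Tendsto (fun h : ℝ => 2 * C * (h ^ τ + h ^ κ)) (𝓝 0) (𝓝 0) := by
      have : ContinuousAt (fun h : ℝ => 2 * C * (h ^ τ + h ^ κ)) 0 := by
        refine continuousAt_const.mul ((Real.continuousAt_rpow_const _ _ (Or.inr hτ.le)).add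
          (Real.continuousAt_rpow_const _ _ (Or.inr hκ.le)))
      have h2 := this.tendsto
      simpa [Real.zero_rpow hτ.ne', Real.zero_rpow hκ.ne'] using h2
    have c2 := (c1.eventually (gt_mem_nhds (show (0 : ℝ) < 1 / 2 by norm_num)))
    rw [Metric.eventually_nhds_iff] at c2
    obtain ⟨r, hr, c2⟩ := c2
    refine ⟨min (r / 2) 1, by positivity, min_le_right _ _, (c2 ?_).le⟩
    rw [Real.dist_eq, sub_zero, abs_of_pos (by positivity)]
    exact (min_le_left _ _).trans_lt (by linarith)
  obtain ⟨M, hM⟩ := exists_nat_ge (T / h)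
  rw [div_le_iff₀ hh0] at hM
  set A : ℝ := (1 + 4 * C) ^ M with hA
  have hA1 : 1 ≤ A := one_le_pow₀ (by linarith)
  have hhτ : 0 < h ^ τ := Real.rpow_pos_of_pos hh0 _
  refine ⟨A + 4 * C * A + 2 * A / h ^ τ, by positivity, ?_⟩
  intro f e n0 he hn0 hf H
  -- symmetric version
  have H' : ∀ a b N n : ℝ, -T ≤ a → b ≤ T → b - a ≤ 1 → 0 ≤ N → 0 ≤ n →
        (∀ u, a ≤ u → u ≤ b → ‖f u‖ ≤ N) →
        (∀ u v, a ≤ u → u ≤ v → v ≤ b → ‖f v - f u‖ ≤ n * (v - u) ^ τ) →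
        ∀ s t, a ≤ s → s ≤ t → t ≤ b →
          ‖f t - f s‖ ≤ 2 * C * (e + N + n * (t - s) ^ κ) * (t - s) ^ τ := by
    intro a b N n ha hb hab hN hn h1 h2 s t hs hst ht
    have hmon : ∀ r, 0 ≤ r → r ≤ t - s → C * (e + N + n * r ^ κ) * r ^ τ ≤
        C * (e + N + n * (t - s) ^ κ) * (t - s) ^ τ := by
      intro r hr0 hr
      have := Real.rpow_nonneg (hr0.trans hr) κ
      gcongr
    have hpos : 0 ≤ C * (e + N + n * (t - s) ^ κ) * (t - s) ^ τ := by
      have := Real.rpow_nonneg (sub_nonneg.2 hst) κ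
      have := Real.rpow_nonneg (sub_nonneg.2 hst) τ
      positivity
    have key := H a b N n ha hb hab hN hn h1 h2
    rcases hst.eq_or_lt with rfl | hst'
    · simp only [sub_self, norm_zero]; simp only [sub_self] at hpos; linarith
    · by_cases hc : 0 ≤ s ∨ t ≤ 0
      · have := key s t hs hst' ht hc
        linarith
      · push Not at hc
        have k1 := key s 0 hs hc.1 (by linarith) (Or.inr le_rfl)
        have k2 := key 0 t (by linarith) hc.2 ht (Or.inl le_rfl)
        have k3 := hmon (0 - s) (by linarith) (by linarith)
        have k4 := hmon (t - 0) (by linarith) (by linarith)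
        have : f t - f s = (f t - f 0) + (f 0 - f s) := by abel
        rw [this]
        refine (norm_add_le _ _).trans ?_
        linarith
  -- local estimate
  have loc : ∀ a b c : ℝ, -T ≤ a → b ≤ T → b - a ≤ h → a ≤ c → c ≤ b →
      ∀ s t, a ≤ s → s ≤ t → t ≤ b → ‖f t - f s‖ ≤ 4 * C * (e + ‖f c‖) * (t - s) ^ τ := by
    intro a b c ha hb hab hac hcb
    have it : ∀ k : ℕ, ∀ s t, a ≤ s → s ≤ t → t ≤ b →
        ‖f t - f s‖ ≤ (4 * C * (e + ‖f c‖) + n0 * (1 / 2) ^ k) * (t - s) ^ τ := by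
      intro k
      induction k with
      | zero =>
        intro s t hs hst ht
        refine (hf s t (by linarith) hst (by linarith)).trans ?_
        have := Real.rpow_nonneg (sub_nonneg.2 hst) τ
        have : 0 ≤ 4 * C * (e + ‖f c‖) := by positivity
        gcongr
        simp; linarith
      | succ k ih =>
        intro s t hs hst ht
        set n := 4 * C * (e + ‖f c‖) + n0 * (1 / 2) ^ k with hn
        have hn' : 0 ≤ n := by positivity
        have hsup : ∀ u, a ≤ u → u ≤ b → ‖f u‖ ≤ ‖f c‖ + n * h ^ τ := by
          intro u hu1 hu2
          have : ‖f u - f c‖ ≤ n * h ^ τ := by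
            rcases le_total c u with hcu | huc
            · refine (ih c u hac hcu hu2).trans ?_
              have : u - c ≤ h := by linarith
              have := Real.rpow_le_rpow (by linarith) this hτ.le
              gcongr
            · rw [norm_sub_rev]
              refine (ih u c hu1 huc hcb).trans ?_
              have : c - u ≤ h := by linarith
              have := Real.rpow_le_rpow (by linarith) this hτ.le
              gcongr
          have h3 := norm_le_norm_add_norm_sub (f c) (f u)
          rw [norm_sub_rev] at h3
          linarith
        have := H' a b (‖f c‖ + n * h ^ τ) n ha hb (by linarith) (by positivity) hn' hsup ih
          s t hs hst ht
        refine this.trans ?_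
        have hts := Real.rpow_nonneg (sub_nonneg.2 hst) τ
        refine mul_le_mul_of_nonneg_right ?_ hts
        have hκ' : (t - s) ^ κ ≤ h ^ κ := Real.rpow_le_rpow (by linarith) (by linarith) hκ.le
        calc 2 * C * (e + (‖f c‖ + n * h ^ τ) + n * (t - s) ^ κ)
            ≤ 2 * C * (e + (‖f c‖ + n * h ^ τ) + n * h ^ κ) := by gcongr
          _ = 2 * C * (e + ‖f c‖) + n * (2 * C * (h ^ τ + h ^ κ)) := by ring
          _ ≤ 2 * C * (e + ‖f c‖) + n * (1 / 2) := by gcongr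
          _ = _ := by rw [hn]; ring
    intro s t hs hst ht
    have lim : Tendsto (fun k : ℕ => (4 * C * (e + ‖f c‖) + n0 * (1 / 2 : ℝ) ^ k) * (t - s) ^ τ)
        atTop (𝓝 ((4 * C * (e + ‖f c‖) + n0 * 0) * (t - s) ^ τ)) := by
      refine Tendsto.mul_const _ (Tendsto.const_add _ (Tendsto.const_mul _ ?_))
      exact tendsto_pow_atTop_nhds_zero_of_lt_one (by norm_num) (by norm_num)
    rw [mul_zero, add_zero] at lim
    exact ge_of_tendsto lim (Eventually.of_forall fun k => it k s t hs hst ht)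
  -- one-step growth
  have grow : ∀ c u : ℝ, -T ≤ c → c ≤ T → -T ≤ u → u ≤ T → |u - c| ≤ h →
      e + ‖f u‖ ≤ (1 + 4 * C) * (e + ‖f c‖) := by
    intro c u hc1 hc2 hu1 hu2 huc
    have hle : ‖f u - f c‖ ≤ 4 * C * (e + ‖f c‖) := by
      have hE : 0 ≤ 4 * C * (e + ‖f c‖) := by positivity
      have aux : ∀ r : ℝ, 0 ≤ r → r ≤ h → 4 * C * (e + ‖f c‖) * r ^ τ ≤ 4 * C * (e + ‖f c‖) := by
        intro r h0 h1
        have : r ^ τ ≤ 1 := Real.rpow_le_one h0 (by linarith) hτ.le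
        nlinarith
      rw [abs_le] at huc
      rcases le_total c u with h1 | h1
      · exact (loc c u c hc1 hu2 (by linarith) le_rfl h1 c u le_rfl h1 le_rfl).trans
          (aux _ (by linarith) (by linarith))
      · rw [norm_sub_rev]
        exact (loc u c c hu1 hc2 (by linarith) h1 le_rfl u c le_rfl h1 le_rfl).trans
          (aux _ (by linarith) (by linarith))
    have h3 := norm_le_norm_add_norm_sub (f c) (f u)
    rw [norm_sub_rev] at h3
    linarith
  have iter : ∀ k : ℕ, ∀ t, -T ≤ t → t ≤ T → |t| ≤ k * h →
      e + ‖f t‖ ≤ (1 + 4 * C) ^ k * (e + ‖f 0‖) := by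
    intro k
    induction k with
    | zero =>
      intro t _ _ ht
      have : t = 0 := by
        rw [← abs_nonpos_iff]; simpa using ht
      simp [this]
    | succ k ih =>
      intro t ht1 ht2 ht
      push_cast at ht
      have hk : (0 : ℝ) ≤ k * h := by positivity
      obtain ⟨c, hc1, hc2, hc3, hc4⟩ : ∃ c, -T ≤ c ∧ c ≤ T ∧ |c| ≤ k * h ∧ |t - c| ≤ h := by
        rcases le_total 0 t with h0 | h0
        · rw [abs_of_nonneg h0] at ht
          rcases le_total t h with h1 | h1
          · exact ⟨0, by linarith, by linarith, by simpa using hk, by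
              rw [sub_zero, abs_of_nonneg h0]; exact h1⟩
          · exact ⟨t - h, by linarith, by linarith, by
              rw [abs_of_nonneg (by linarith)]; linarith, by
              rw [sub_sub_cancel, abs_of_pos hh0]⟩
        · rw [abs_of_nonpos h0] at ht
          rcases le_total (-t) h with h1 | h1
          · exact ⟨0, by linarith, by linarith, by simpa using hk, by
              rw [sub_zero, abs_of_nonpos h0]; exact h1⟩
          · exact ⟨t + h, by linarith, by linarith, by
              rw [abs_of_nonpos (by linarith)]; linarith, by
              rw [show t - (t + h) = -h by ring, abs_neg, abs_of_pos hh0]⟩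
      have i1 := ih c hc1 hc2 hc3
      have i2 := grow c t hc1 hc2 ht1 ht2 hc4
      calc e + ‖f t‖ ≤ (1 + 4 * C) * (e + ‖f c‖) := i2
        _ ≤ (1 + 4 * C) * ((1 + 4 * C) ^ k * (e + ‖f 0‖)) := by gcongr
        _ = _ := by ring
  have glob : ∀ t, -T ≤ t → t ≤ T → e + ‖f t‖ ≤ A * (e + ‖f 0‖) := fun t h1 h2 =>
    iter M t h1 h2 ((abs_le.2 ⟨h1, h2⟩).trans hM)
  have hE : 0 ≤ e + ‖f 0‖ := by positivity
  have p1 : 0 ≤ 4 * C * A * (e + ‖f 0‖) := by positivity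
  have p2 : 0 ≤ 2 * A / h ^ τ * (e + ‖f 0‖) := by positivity
  have p3 : 0 ≤ A * (e + ‖f 0‖) := by positivity
  refine ⟨fun t h1 h2 => ?_, fun s t hs hst ht => ?_⟩
  · have := glob t h1 h2
    nlinarith
  · have hts := Real.rpow_nonneg (sub_nonneg.2 hst) τ
    by_cases hc : t - s ≤ h
    · refine (loc s t s hs ht hc le_rfl hst s t le_rfl hst le_rfl).trans ?_
      refine mul_le_mul_of_nonneg_right ?_ hts
      have := glob s hs (by linarith)
      calc 4 * C * (e + ‖f s‖) ≤ 4 * C * (A * (e + ‖f 0‖)) := by gcongr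
        _ ≤ _ := by nlinarith
    · push Not at hc
      have g1 := glob s hs (by linarith)
      have g2 := glob t (by linarith) ht
      have : h ^ τ ≤ (t - s) ^ τ := Real.rpow_le_rpow hh0.le hc.le hτ.le
      calc ‖f t - f s‖ ≤ ‖f t‖ + ‖f s‖ := norm_sub_le _ _
        _ ≤ 2 * A * (e + ‖f 0‖) := by linarith
        _ = 2 * A / h ^ τ * (e + ‖f 0‖) * h ^ τ := by field_simp
        _ ≤ 2 * A / h ^ τ * (e + ‖f 0‖) * (t - s) ^ τ := by gcongr
        _ ≤ _ := by
          refine mul_le_mul_of_nonneg_right ?_ hts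
          nlinarith

/-- Four-point estimate for a `C^{1,λ}` function on a ball. -/
lemma four_point {E F : Type*} [NormedAddCommGroup E] [NormedSpace ℝ E] [NormedAddCommGroup F]
    [NormedSpace ℝ F] {G : E → F} (hG : Differentiable ℝ G) {S : Set E} (hS : Convex ℝ S)
    {Λ lam r : ℝ} (hlam : 0 < lam) (hΛ : 0 ≤ Λ)
    (h1 : ∀ x ∈ S, ‖fderiv ℝ G x‖ ≤ Λ)
    (h2 : ∀ x ∈ S, ∀ y ∈ S, ‖fderiv ℝ G x - fderiv ℝ G y‖ ≤ Λ * ‖x - y‖ ^ lam)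
    {a b c d : E} (ha : a ∈ S) (hb : b ∈ S) (hc : c ∈ S) (hd : d ∈ S)
    (hac : ‖a - c‖ ≤ r) (hbd : ‖b - d‖ ≤ r) :
    ‖G a - G b - (G c - G d)‖ ≤ Λ * r ^ lam * ‖a - b‖ + Λ * ‖a - b - (c - d)‖ := by
  let p : ℝ → F := fun θ => G (b + θ • (a - b)) - G (d + θ • (c - d))
  have hp : ∀ θ : ℝ, HasDerivAt p (fderiv ℝ G (b + θ • (a - b)) (a - b)
      - fderiv ℝ G (d + θ • (c - d)) (c - d)) θ := by
    intro θ
    have l : ∀ v w : E, HasDerivAt (fun θ : ℝ => G (v + θ • w)) (fderiv ℝ G (v + θ • w) w) θ := by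
      intro v w
      have h0 : HasDerivAt (fun θ : ℝ => v + θ • w) w θ := by
        simpa using ((hasDerivAt_id θ).smul_const w).const_add v
      exact (hG (v + θ • w)).hasFDerivAt.comp_hasDerivAt θ h0
    exact (l b (a - b)).sub (l d (c - d))
  have bound : ∀ θ ∈ Set.Ico (0 : ℝ) 1, ‖fderiv ℝ G (b + θ • (a - b)) (a - b)
      - fderiv ℝ G (d + θ • (c - d)) (c - d)‖
      ≤ Λ * r ^ lam * ‖a - b‖ + Λ * ‖a - b - (c - d)‖ := by
    rintro θ ⟨hθ0, hθ1⟩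
    have hP : b + θ • (a - b) ∈ S := hS.add_smul_sub_mem hb ha ⟨hθ0, hθ1.le⟩
    have hQ : d + θ • (c - d) ∈ S := hS.add_smul_sub_mem hd hc ⟨hθ0, hθ1.le⟩
    set P := b + θ • (a - b) with hPd
    set Q := d + θ • (c - d) with hQd
    have hPQ : ‖P - Q‖ ≤ r := by
      have : P - Q = (1 - θ) • (b - d) + θ • (a - c) := by
        rw [hPd, hQd]; module
      rw [this]
      refine (norm_add_le _ _).trans ?_
      rw [norm_smul, norm_smul, Real.norm_of_nonneg hθ0, Real.norm_of_nonneg (by linarith)]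
      nlinarith
    have e : fderiv ℝ G P (a - b) - fderiv ℝ G Q (c - d)
        = (fderiv ℝ G P - fderiv ℝ G Q) (a - b) + fderiv ℝ G Q (a - b - (c - d)) := by
      rw [map_sub (fderiv ℝ G Q) (a - b) (c - d), ContinuousLinearMap.sub_apply]; abel
    rw [e]
    refine (norm_add_le _ _).trans (add_le_add ?_ ?_)
    · refine (ContinuousLinearMap.le_opNorm _ _).trans ?_
      refine mul_le_mul_of_nonneg_right ((h2 P hP Q hQ).trans ?_) (norm_nonneg _)
      have := Real.rpow_le_rpow (norm_nonneg _) hPQ hlam.le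
      gcongr
    · refine (ContinuousLinearMap.le_opNorm _ _).trans ?_
      exact mul_le_mul_of_nonneg_right (h1 Q hQ) (norm_nonneg _)
  have := norm_image_sub_le_of_norm_deriv_le_segment_01' (f := p)
    (fun θ _ => (hp θ).hasDerivWithinAt) bound
  have e : p 1 - p 0 = G a - G b - (G c - G d) := by
    simp [p]; abel
  rwa [e] at this

/-- Uniform Riemann sums converge to increments of the solution. -/
lemma sol_tendsto {d : ℕ} {W : ℝ → EuclideanSpace ℝ (Fin d) → EuclideanSpace ℝ (Fin d)}
    {f : ℝ → EuclideanSpace ℝ (Fin d)}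
    (hsol : ∀ t : ℝ, HasSignedYoungIntegral W f 0 t (f t - f 0))
    {s t : ℝ} (hst : s < t) (h : 0 ≤ s ∨ t ≤ 0) :
    Tendsto (unifSum (youngGerm W f) s t) atTop (𝓝 (f t - f s)) := by
  have pos : ∀ t, 0 < t → RiemannLimit 0 t (youngGerm W f) (f t - f 0) := by
    intro t ht
    rcases hsol t with h | h
    · exact h.2
    · exact absurd h.1 (by linarith)
  have neg : ∀ t, t < 0 → RiemannLimit t 0 (youngGerm W f) (f 0 - f t) := by
    intro t ht
    rcases hsol t with h | h
    · exact absurd h.1 (by linarith)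
    · have := h.2
      rw [neg_sub] at this
      exact this
  rcases h with h | h
  · rcases h.eq_or_lt with rfl | h0
    · exact tendsto_unifSum hst (pos t hst)
    · have h1 := tendsto_unifSum_add h0 hst (pos t (by linarith))
      have h2 := tendsto_unifSum h0 (pos s h0)
      simpa using h1.sub h2
  · rcases h.eq_or_lt with rfl | h0
    · exact tendsto_unifSum hst (neg s hst)
    · have h1 := tendsto_unifSum_add hst h0 (neg s (by linarith))
      have h2 := tendsto_unifSum h0 (neg t h0)
      simpa using h1.sub h2

lemma unifSum_sub {B : Type*} [NormedAddCommGroup B] (μ ν : ℝ → ℝ → B) (a b : ℝ) (N : ℕ) :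
    unifSum (fun u v => μ u v - ν u v) a b N = unifSum μ a b N - unifSum ν a b N := by
  simp [unifSum, Finset.sum_sub_distrib]

lemma holder_const {F : Type*} [NormedAddCommGroup F] {f : ℝ → F} {τ T : ℝ}
    (h : HolderOn f τ (-T) T) : ∃ n : ℝ, 0 ≤ n ∧ ∀ u v, -T ≤ u → u ≤ v → v ≤ T →
      ‖f v - f u‖ ≤ n * (v - u) ^ τ := by
  obtain ⟨n, hn⟩ := h
  refine ⟨max n 0, le_max_right _ _, fun u v hu huv hv => ?_⟩
  rcases huv.eq_or_lt with rfl | huv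
  · simp only [sub_self, norm_zero]; have := Real.rpow_nonneg (le_refl (0 : ℝ)) τ; positivity
  · have hp : 0 < (v - u) ^ τ := Real.rpow_pos_of_pos (sub_pos.2 huv) _
    have := hn ⟨u, v, hu, huv, hv, rfl⟩
    rw [div_le_iff₀ hp] at this
    exact this.trans (by gcongr; exact le_max_left _ _)

/-- Constants extracted from condition (W). -/
lemma condW_const {d : ℕ} {W : ℝ → EuclideanSpace ℝ (Fin d) → EuclideanSpace ℝ (Fin d)}
    {β τ lam T : ℝ} (hlam : 0 < lam) (h : ConditionW W β τ lam (-T) T) :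
    ∃ w : ℝ, 0 ≤ w ∧
      (∀ s t x y, -T ≤ s → s < t → t ≤ T → ‖(W t x - W s x) - (W t y - W s y)‖
        ≤ w * ((1 + ‖x‖ + ‖y‖) ^ β * (t - s) ^ τ * ‖x - y‖ ^ lam)) ∧
      (∀ s t x, -T ≤ s → s < t → t ≤ T → ‖W t x - W s x‖
        ≤ w * ((1 + ‖x‖) ^ (β + lam) * (t - s) ^ τ)) := by
  obtain ⟨⟨w1, h1⟩, ⟨w2, h2⟩, -⟩ := h
  refine ⟨max (max w1 w2) 0, le_max_right _ _, ?_, ?_⟩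
  · intro s t x y hs hst ht
    rcases eq_or_ne x y with rfl | hxy
    · simp [Real.zero_rpow hlam.ne']
    · have p1 : 0 < (1 + ‖x‖ + ‖y‖) ^ β := Real.rpow_pos_of_pos (by positivity) _
      have p2 : 0 < (t - s) ^ τ := Real.rpow_pos_of_pos (sub_pos.2 hst) _
      have p3 : 0 < ‖x - y‖ ^ lam := Real.rpow_pos_of_pos (norm_pos_iff.2 (sub_ne_zero.2 hxy)) _
      have := h1 ⟨s, t, x, y, hs, hst, ht, hxy, rfl⟩
      rw [div_le_iff₀ (by positivity)] at this
      have e : (W t x - W s x) - (W t y - W s y) = -(W s x - W t x - W s y + W t y) := by abel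
      rw [e, norm_neg]
      exact this.trans (by gcongr; exact (le_max_left _ _).trans (le_max_left _ _))
  · intro s t x hs hst ht
    have p1 : 0 < (1 + ‖x‖) ^ (β + lam) := Real.rpow_pos_of_pos (by positivity) _
    have p2 : 0 < (t - s) ^ τ := Real.rpow_pos_of_pos (sub_pos.2 hst) _
    have := h2 ⟨s, t, x, hs, hst, ht, rfl⟩
    rw [div_le_iff₀ (by positivity)] at this
    rw [norm_sub_rev]
    exact this.trans (by gcongr; exact (le_max_right _ _).trans (le_max_left _ _))

/-- Constants extracted from the gradient assumption. -/
lemma grad_const {d : ℕ} {W : ℝ → EuclideanSpace ℝ (Fin d) → EuclideanSpace ℝ (Fin d)}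
    {τ lam T : ℝ} (hlam : 0 < lam) {K : Set (EuclideanSpace ℝ (Fin d))}
    (h : BddAbove (gradWSet1 W τ (-T) T K) ∧ BddAbove (gradWSet2 W τ lam (-T) T K)) :
    ∃ L : ℝ, 0 ≤ L ∧
      (∀ s t, -T ≤ s → s < t → t ≤ T → ∀ x ∈ K, ‖gradW W t x - gradW W s x‖
        ≤ L * (t - s) ^ τ) ∧
      (∀ s t, -T ≤ s → s < t → t ≤ T → ∀ x ∈ K, ∀ y ∈ K,
        ‖(gradW W t x - gradW W s x) - (gradW W t y - gradW W s y)‖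
        ≤ L * (t - s) ^ τ * ‖x - y‖ ^ lam) := by
  obtain ⟨⟨w1, h1⟩, ⟨w2, h2⟩⟩ := h
  refine ⟨max (max w1 w2) 0, le_max_right _ _, ?_, ?_⟩
  · intro s t hs hst ht x hx
    have p2 : 0 < (t - s) ^ τ := Real.rpow_pos_of_pos (sub_pos.2 hst) _
    have := h1 ⟨s, t, x, hs, hst, ht, hx, rfl⟩
    rw [div_le_iff₀ (by positivity)] at this
    exact this.trans (by gcongr; exact (le_max_left _ _).trans (le_max_left _ _))
  · intro s t hs hst ht x hx y hy
    rcases eq_or_ne x y with rfl | hxy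
    · simp [Real.zero_rpow hlam.ne']
    · have p2 : 0 < (t - s) ^ τ := Real.rpow_pos_of_pos (sub_pos.2 hst) _
      have p3 : 0 < ‖x - y‖ ^ lam := Real.rpow_pos_of_pos (norm_pos_iff.2 (sub_ne_zero.2 hxy)) _
      have := h2 ⟨s, t, x, y, hs, hst, ht, hx, hy, hxy, rfl⟩
      rw [div_le_iff₀ (by positivity)] at this
      have e : (gradW W t x - gradW W s x) - (gradW W t y - gradW W s y)
        = gradW W t x - gradW W s x - gradW W t y + gradW W s y := by abel
      rw [e, mul_assoc]
      exact this.trans (by gcongr; exact (le_max_right _ _).trans (le_max_left _ _))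

/-- A priori bound on solutions. -/
lemma apriori {d : ℕ} {W : ℝ → EuclideanSpace ℝ (Fin d) → EuclideanSpace ℝ (Fin d)}
    {β τ lam T : ℝ} (hT : 0 < T) (hτ : 0 < τ) (hlam : 0 < lam) (hβ : 0 ≤ β)
    (hτlam : 1 < τ * (1 + lam)) (hβlam : β + lam ≤ 1)
    (hW : ConditionW W β τ lam (-T) T) :
    ∃ D : ℝ, 0 ≤ D ∧ ∀ f : ℝ → EuclideanSpace ℝ (Fin d), HolderOn f τ (-T) T →
      (∀ t : ℝ, HasSignedYoungIntegral W f 0 t (f t - f 0)) →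
      (∀ t, -T ≤ t → t ≤ T → ‖f t‖ ≤ D * (1 + ‖f 0‖)) ∧
      (∀ s t, -T ≤ s → s ≤ t → t ≤ T → ‖f t - f s‖ ≤ D * (1 + ‖f 0‖) * (t - s) ^ τ) := by
  obtain ⟨w, hw, w1, w2⟩ := condW_const hlam hW
  have hθ : 1 < τ + τ * lam := by linarith
  have hκ : 0 < τ * lam := by positivity
  have hS := sewC_pos hθ
  obtain ⟨D, hD, HD⟩ := gronwall_abs (B := EuclideanSpace ℝ (Fin d)) (T := T) (τ := τ)
    (κ := τ * lam) (C := w * (1 + 2 * sewC (τ + τ * lam))) hT hτ hκ (by positivity)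
  refine ⟨D, hD, fun f hf hsol => ?_⟩
  obtain ⟨n0, hn0, hf'⟩ := holder_const hf
  refine HD f 1 n0 zero_le_one hn0 hf' ?_
  intro a b N n ha hb hab hN hn hsup hhol s t hs hst ht hside
  have hI := sol_tendsto hsol hst hside
  have hδ : ∀ u v, s ≤ u → u < v → v ≤ t →
      ‖youngGerm W f u v - youngGerm W f u ((u + v) / 2) - youngGerm W f ((u + v) / 2) v‖
        ≤ (w * (1 + 2 * N + n)) * (v - u) ^ (τ + τ * lam) := by
    intro u v hu huv hv
    set m := (u + v) / 2 with hm
    have e : youngGerm W f u v - youngGerm W f u m - youngGerm W f m v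
        = (W v (f u) - W m (f u)) - (W v (f m) - W m (f m)) := by
      simp only [youngGerm]; abel
    rw [e]
    refine (w1 m v (f u) (f m) (by linarith) (by linarith) (by linarith)).trans ?_
    rw [mul_assoc w (1 + 2 * N + n)]
    refine mul_le_mul_of_nonneg_left ?_ hw
    have hvu : 0 < v - u := sub_pos.2 huv
    have b1 : (1 + ‖f u‖ + ‖f m‖) ^ β ≤ (1 + 2 * N + n) ^ β := by
      refine Real.rpow_le_rpow (by positivity) ?_ hβ
      have := hsup u (by linarith) (by linarith)
      have := hsup m (by linarith) (by linarith)
      linarith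
    have b2 : (v - m) ^ τ ≤ (v - u) ^ τ :=
      Real.rpow_le_rpow (by linarith) (by linarith) hτ.le
    have b3 : ‖f u - f m‖ ^ lam ≤ (1 + 2 * N + n) ^ lam * (v - u) ^ (τ * lam) := by
      rw [Real.rpow_mul hvu.le, ← Real.mul_rpow (by positivity) (by positivity)]
      refine Real.rpow_le_rpow (by positivity) ?_ hlam.le
      rw [norm_sub_rev]
      refine (hhol u m (by linarith) (by linarith) (by linarith)).trans ?_
      have : (m - u) ^ τ ≤ (v - u) ^ τ := Real.rpow_le_rpow (by linarith) (by linarith) hτ.le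
      have h0 := Real.rpow_nonneg (show 0 ≤ m - u by linarith) τ
      gcongr
      linarith
    have h1 := Real.rpow_nonneg (show 0 ≤ v - m by linarith) τ
    have b4 : (1 + 2 * N + n) ^ β * (1 + 2 * N + n) ^ lam ≤ 1 + 2 * N + n := by
      rw [← Real.rpow_add (by positivity)]
      conv_rhs => rw [← Real.rpow_one (1 + 2 * N + n)]
      exact Real.rpow_le_rpow_of_exponent_le (by linarith) hβlam
    rw [Real.rpow_add hvu]
    calc (1 + ‖f u‖ + ‖f m‖) ^ β * (v - m) ^ τ * ‖f u - f m‖ ^ lam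
        ≤ (1 + 2 * N + n) ^ β * (v - u) ^ τ * ((1 + 2 * N + n) ^ lam * (v - u) ^ (τ * lam)) := by
          gcongr
      _ = ((1 + 2 * N + n) ^ β * (1 + 2 * N + n) ^ lam) * ((v - u) ^ τ * (v - u) ^ (τ * lam)) := by
          ring
      _ ≤ _ := by gcongr
  have hsew := sewing hθ hst hδ hI
  have hts : 0 < t - s := sub_pos.2 hst
  rw [Real.rpow_add hts] at hsew
  have hg : ‖youngGerm W f s t‖ ≤ w * (1 + N) * (t - s) ^ τ := by
    refine (w2 s t (f s) (by linarith) hst (by linarith)).trans ?_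
    rw [mul_assoc]
    have : (1 + ‖f s‖) ^ (β + lam) ≤ 1 + N := by
      have h1 := hsup s hs (by linarith)
      have h2 : (1 + ‖f s‖) ^ (β + lam) ≤ (1 + ‖f s‖) ^ (1 : ℝ) :=
        Real.rpow_le_rpow_of_exponent_le (by linarith [norm_nonneg (f s)]) hβlam
      rw [Real.rpow_one] at h2
      linarith
    gcongr
  have hk1 : (t - s) ^ (τ * lam) ≤ 1 := Real.rpow_le_one hts.le (by linarith) hκ.le
  have hk0 : 0 ≤ (t - s) ^ (τ * lam) := by positivity
  have e : f t - f s = youngGerm W f s t + (f t - f s - youngGerm W f s t) := by abel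
  rw [e]
  refine (norm_add_le _ _).trans ((add_le_add hg hsew).trans ?_)
  have hτ0 : 0 ≤ (t - s) ^ τ := by positivity
  set k := (t - s) ^ (τ * lam) with hk
  have key : (1 + 2 * N + n) * k ≤ 2 * (1 + N + n * k) := by
    have : 0 ≤ n * k := by positivity
    nlinarith
  have p0 : 0 ≤ n * k := by positivity
  calc w * (1 + N) * (t - s) ^ τ + sewC (τ + τ * lam) * (w * (1 + 2 * N + n)) * ((t - s) ^ τ * k)
      = w * ((1 + N) + sewC (τ + τ * lam) * ((1 + 2 * N + n) * k)) * (t - s) ^ τ := by ring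
    _ ≤ w * ((1 + N + n * k) + sewC (τ + τ * lam) * (2 * (1 + N + n * k))) * (t - s) ^ τ := by
        refine mul_le_mul_of_nonneg_right (mul_le_mul_of_nonneg_left
          (add_le_add (by linarith) (mul_le_mul_of_nonneg_left key hS.le)) hw) hτ0
    _ = _ := by ring

/-- **Joint Hölder continuity of the flow** (Theorem 3.6 (iii)): the flow
`φ(t,x) = x + ∫_0^t W(ds, φ(s,x))` satisfies, on every `[−T,T]` and compact `K`,
`|φ(s,x) − φ(s,y) − φ(t,x) + φ(t,y)| ≤ C |t−s|^τ |x−y|`. -/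
theorem flow_joint_holder
    (d : ℕ) (W : ℝ → EuclideanSpace ℝ (Fin d) → EuclideanSpace ℝ (Fin d))
    (β τ lam : ℝ)
    (hτ : τ ∈ Set.Ioc (0 : ℝ) 1) (hlam : lam ∈ Set.Ioc (0 : ℝ) 1) (hβ : 0 ≤ β)
    (hτlam : 1 < τ * (1 + lam)) (hβlam : β + lam ≤ 1)
    (hW : ∀ a b : ℝ, a < b → ConditionW W β τ lam a b)
    (hdiff : ∀ t : ℝ, Differentiable ℝ (W t))
    (hgrad : ∀ T : ℝ, 0 < T → ∀ K : Set (EuclideanSpace ℝ (Fin d)), IsCompact K →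
      BddAbove (gradWSet1 W τ (-T) T K) ∧ BddAbove (gradWSet2 W τ lam (-T) T K))
    (φ : ℝ → EuclideanSpace ℝ (Fin d) → EuclideanSpace ℝ (Fin d))
    (hφ0 : ∀ x : EuclideanSpace ℝ (Fin d), φ 0 x = x)
    (hφholder : ∀ (x : EuclideanSpace ℝ (Fin d)) (T : ℝ), 0 < T →
      HolderOn (fun s => φ s x) τ (-T) T)
    (hφsol : ∀ (x : EuclideanSpace ℝ (Fin d)) (t : ℝ),
      HasSignedYoungIntegral W (fun s => φ s x) 0 t (φ t x - x)) :
    ∀ T : ℝ, 0 < T → ∀ K : Set (EuclideanSpace ℝ (Fin d)), IsCompact K →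
      ∃ C : ℝ, 0 ≤ C ∧
        ∀ s ∈ Set.Icc (-T) T, ∀ t ∈ Set.Icc (-T) T, ∀ x ∈ K, ∀ y ∈ K,
          ‖φ s x - φ s y - φ t x + φ t y‖ ≤ C * |t - s| ^ τ * ‖x - y‖ := by
  intro T hT K hK
  obtain ⟨hτ0, hτ1⟩ := hτ
  obtain ⟨hl0, hl1⟩ := hlam
  have hsol : ∀ x t, HasSignedYoungIntegral W (fun s => φ s x) 0 t (φ t x - φ 0 x) := by
    intro x t; rw [hφ0]; exact hφsol x t
  obtain ⟨D, hD, HD⟩ := apriori hT hτ0 hl0 hβ hτlam hβlam (hW (-T) T (by linarith))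
  obtain ⟨R0, hR0⟩ := hK.isBounded.exists_norm_le
  set R : ℝ := D * (1 + max R0 0) with hRdef
  have hR : 0 ≤ R := by positivity
  have hx1 : ∀ x ∈ K, ∀ t, -T ≤ t → t ≤ T → φ t x ∈ Metric.closedBall 0 R := by
    intro x hx t h1 h2
    rw [mem_closedBall_zero_iff]
    refine ((HD (fun s => φ s x) (hφholder x T hT) (hsol x)).1 t h1 h2).trans ?_
    rw [hφ0, hRdef]
    have := (hR0 x hx).trans (le_max_left _ 0)
    gcongr
  have hx2 : ∀ x ∈ K, ∀ s t, -T ≤ s → s ≤ t → t ≤ T → ‖φ t x - φ s x‖ ≤ R * (t - s) ^ τ := by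
    intro x hx s t h1 h2 h3
    refine ((HD (fun s => φ s x) (hφholder x T hT) (hsol x)).2 s t h1 h2 h3).trans ?_
    rw [hφ0, hRdef]
    have := (hR0 x hx).trans (le_max_left _ 0)
    have := Real.rpow_nonneg (sub_nonneg.2 h2) τ
    gcongr
  obtain ⟨L, hL, L1, L2⟩ := grad_const hl0
    (hgrad T hT (Metric.closedBall 0 R) (isCompact_closedBall _ _))
  have hθ : 1 < τ + τ * lam := by linarith
  have hκ : 0 < τ * lam := by positivity
  have hS := sewC_pos hθ
  have hRl : 0 ≤ R ^ lam := by positivity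
  obtain ⟨D', hD', HD'⟩ := gronwall_abs (B := EuclideanSpace ℝ (Fin d)) (T := T) (τ := τ)
    (κ := τ * lam) (C := L * (1 + (1 + R ^ lam) * sewC (τ + τ * lam))) hT hτ0 hκ (by positivity)
  have main : ∀ x ∈ K, ∀ y ∈ K, ∀ s t, -T ≤ s → s ≤ t → t ≤ T →
      ‖(φ t x - φ t y) - (φ s x - φ s y)‖ ≤ D' * ‖x - y‖ * (t - s) ^ τ := by
    intro x hx y hy
    have hn0 : ∀ u v, -T ≤ u → u ≤ v → v ≤ T →
        ‖(φ v x - φ v y) - (φ u x - φ u y)‖ ≤ (R + R) * (v - u) ^ τ := by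
      intro u v h1 h2 h3
      have e : (φ v x - φ v y) - (φ u x - φ u y) = (φ v x - φ u x) - (φ v y - φ u y) := by abel
      rw [e, add_mul]
      exact (norm_sub_le _ _).trans (add_le_add (hx2 x hx u v h1 h2 h3) (hx2 y hy u v h1 h2 h3))
    have := (HD' (fun t => φ t x - φ t y) 0 (R + R) le_rfl (by positivity) hn0 ?_).2
    · simpa [hφ0] using this
    intro a b N n ha hb hab hN hn hsup hhol s t hs hst ht hside
    let μ : ℝ → ℝ → EuclideanSpace ℝ (Fin d) := fun u v =>
      youngGerm W (fun s => φ s x) u v - youngGerm W (fun s => φ s y) u v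
    have hI : Tendsto (unifSum μ s t) atTop (𝓝 ((φ t x - φ s x) - (φ t y - φ s y))) := by
      have := (sol_tendsto (hsol x) hst hside).sub (sol_tendsto (hsol y) hst hside)
      refine this.congr fun N => ?_
      exact (unifSum_sub _ _ s t N).symm
    have hGd : ∀ u v, Differentiable ℝ (fun z => W v z - W u z) := fun u v =>
      (hdiff v).sub (hdiff u)
    have hGf : ∀ u v z, fderiv ℝ (fun z => W v z - W u z) z = gradW W v z - gradW W u z := by
      intro u v z
      exact fderiv_fun_sub (hdiff v z) (hdiff u z)
    have hδ : ∀ u v, s ≤ u → u < v → v ≤ t →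
        ‖μ u v - μ u ((u + v) / 2) - μ ((u + v) / 2) v‖
          ≤ (L * (R ^ lam * N + n)) * (v - u) ^ (τ + τ * lam) := by
      intro u v hu huv hv
      set m := (u + v) / 2 with hm
      have e : μ u v - μ u m - μ m v
          = ((W v (φ u x) - W m (φ u x)) - (W v (φ u y) - W m (φ u y)))
            - ((W v (φ m x) - W m (φ m x)) - (W v (φ m y) - W m (φ m y))) := by
        simp only [μ, youngGerm]; abel
      have hvu : 0 < v - u := sub_pos.2 huv
      have hmv : m < v := by linarith
      have hum : u < m := by linarith
      have hvm0 : 0 ≤ (v - m) ^ τ := Real.rpow_nonneg (by linarith) _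
      have hpow : (m - u) ^ τ ≤ (v - u) ^ τ :=
        Real.rpow_le_rpow (by linarith) (by linarith) hτ0.le
      have fp := four_point (G := fun z => W v z - W m z) (hGd m v)
        (convex_closedBall (0 : EuclideanSpace ℝ (Fin d)) R) (Λ := L * (v - m) ^ τ) (lam := lam)
        (r := R * (v - u) ^ τ) hl0 (by positivity)
        (fun z hz => by rw [hGf]; exact L1 m v (by linarith) hmv (by linarith) z hz)
        (fun z hz z' hz' => by
          rw [hGf, hGf]; exact L2 m v (by linarith) hmv (by linarith) z hz z' hz')
        (hx1 x hx u (by linarith) (by linarith)) (hx1 y hy u (by linarith) (by linarith))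
        (hx1 x hx m (by linarith) (by linarith)) (hx1 y hy m (by linarith) (by linarith))
        (by
          rw [norm_sub_rev]
          refine (hx2 x hx u m (by linarith) hum.le (by linarith)).trans ?_
          gcongr)
        (by
          rw [norm_sub_rev]
          refine (hx2 y hy u m (by linarith) hum.le (by linarith)).trans ?_
          gcongr)
      rw [e]
      refine fp.trans ?_
      rw [Real.mul_rpow hR (by positivity), ← Real.rpow_mul hvu.le, Real.rpow_add hvu]
      have b1 : ‖φ u x - φ u y‖ ≤ N := hsup u (by linarith) (by linarith)
      have b2 : ‖φ u x - φ u y - (φ m x - φ m y)‖ ≤ n * (v - u) ^ (τ * lam) := by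
        rw [norm_sub_rev]
        refine (hhol u m (by linarith) hum.le (by linarith)).trans ?_
        have : (v - u) ^ τ ≤ (v - u) ^ (τ * lam) :=
          Real.rpow_le_rpow_of_exponent_ge hvu (by linarith) (by nlinarith)
        gcongr
        exact hpow.trans this
      have b3 : (v - m) ^ τ ≤ (v - u) ^ τ :=
        Real.rpow_le_rpow (by linarith) (by linarith) hτ0.le
      calc L * (v - m) ^ τ * (R ^ lam * (v - u) ^ (τ * lam)) * ‖φ u x - φ u y‖
            + L * (v - m) ^ τ * ‖φ u x - φ u y - (φ m x - φ m y)‖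
          ≤ L * (v - u) ^ τ * (R ^ lam * (v - u) ^ (τ * lam)) * N
            + L * (v - u) ^ τ * (n * (v - u) ^ (τ * lam)) := by gcongr
        _ = _ := by ring
    have hsew := sewing hθ hst hδ hI
    have hts : 0 < t - s := sub_pos.2 hst
    rw [Real.rpow_add hts] at hsew
    have hg : ‖μ s t‖ ≤ L * N * (t - s) ^ τ := by
      have := (convex_closedBall (0 : EuclideanSpace ℝ (Fin d)) R).norm_image_sub_le_of_norm_fderiv_le
        (𝕜 := ℝ) (f := fun z => W t z - W s z) (C := L * (t - s) ^ τ)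
        (fun z _ => hGd s t z)
        (fun z hz => by rw [hGf]; exact L1 s t (by linarith) hst (by linarith) z hz)
        (hx1 y hy s (by linarith) (by linarith)) (hx1 x hx s (by linarith) (by linarith))
      refine this.trans ?_
      have b1 : ‖φ s x - φ s y‖ ≤ N := hsup s hs (by linarith)
      calc L * (t - s) ^ τ * ‖φ s x - φ s y‖ ≤ L * (t - s) ^ τ * N := by gcongr
        _ = _ := by ring
    have hk1 : (t - s) ^ (τ * lam) ≤ 1 := Real.rpow_le_one hts.le (by linarith) hκ.le
    have hk0 : 0 ≤ (t - s) ^ (τ * lam) := by positivity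
    have e : (φ t x - φ t y) - (φ s x - φ s y)
        = μ s t + ((φ t x - φ s x) - (φ t y - φ s y) - μ s t) := by abel
    show ‖(φ t x - φ t y) - (φ s x - φ s y)‖ ≤ _
    rw [e]
    refine (norm_add_le _ _).trans ((add_le_add hg hsew).trans ?_)
    have hτ0 : 0 ≤ (t - s) ^ τ := by positivity
    set k := (t - s) ^ (τ * lam) with hk
    have p0 : 0 ≤ n * k := by positivity
    have key : (R ^ lam * N + n) * k ≤ (1 + R ^ lam) * (N + n * k) := by
      have : R ^ lam * N * k ≤ R ^ lam * N := mul_le_of_le_one_right (by positivity) hk1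
      have : 0 ≤ R ^ lam * (n * k) := by positivity
      nlinarith
    calc L * N * (t - s) ^ τ + sewC (τ + τ * lam) * (L * (R ^ lam * N + n)) * ((t - s) ^ τ * k)
        = L * (N + sewC (τ + τ * lam) * ((R ^ lam * N + n) * k)) * (t - s) ^ τ := by ring
      _ ≤ L * ((N + n * k) + sewC (τ + τ * lam) * ((1 + R ^ lam) * (N + n * k)))
            * (t - s) ^ τ := by
          gcongr; linarith
      _ = _ := by ring
  refine ⟨D', hD', ?_⟩
  rintro s ⟨hs1, hs2⟩ t ⟨ht1, ht2⟩ x hx y hy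
  rcases le_total s t with h | h
  · have := main x hx y hy s t hs1 h ht2
    have e : φ s x - φ s y - φ t x + φ t y = -((φ t x - φ t y) - (φ s x - φ s y)) := by abel
    rw [e, norm_neg, abs_of_nonneg (sub_nonneg.2 h)]
    linarith
  · have := main x hx y hy t s ht1 h hs2
    have e : φ s x - φ s y - φ t x + φ t y = (φ s x - φ s y) - (φ t x - φ t y) := by abel
    rw [e, abs_sub_comm, abs_of_nonneg (sub_nonneg.2 h)]
    linarith

end
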